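/- Let X and Y be symmetric and convex subsets of a real vector space E with d_1(X,Y) < ∞, and set l_k(X,Y) := sup{ d_k(X ∩ N, Y) : N a linear subspace of E with dim N ≤ k }. Then for every integer k ≥ 1, l_k(X,Y) ≤ d_k(X,Y) and d_k(X,Y) ≤ k² · l_k(X,Y). -/

import Mathlib

open scoped Pointwise ENNReal Topology

/-- The `k`-th Kolmogoroff diameter of `X` with respect to `Y`:
`inf {c > 0 : ∃ L with dim L < k and X ⊆ c•Y + L}`, in `[0,∞]` (with `inf ∅ = ∞`). -/
noncomputable def kolDiam {E : Type*} [AddCommGroup E] [Module ℝ E] (X Y : Set E) (k : ℕ) : ℝ≥0∞ :=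
  sInf (ENNReal.ofReal '' {c : ℝ | 0 < c ∧
    ∃ L : Submodule ℝ E, Module.rank ℝ L < k ∧ X ⊆ c • Y + (L : Set E)})

/-- `l_k(X,Y) = sup { d_k(X ∩ N, Y) : N ≤ E, dim N ≤ k }`. -/
noncomputable def lkSet {E : Type*} [AddCommGroup E] [Module ℝ E] (X Y : Set E) (k : ℕ) : ℝ≥0∞ :=
  ⨆ (N : Submodule ℝ E) (_ : Module.rank ℝ N ≤ k), kolDiam (X ∩ (N : Set E)) Y k

/-- The absolute polar of `Y` in the algebraic dual of `E`. -/
def absPolar {E : Type*} [AddCommGroup E] [Module ℝ E] (Y : Set E) : Set (Module.Dual ℝ E) :=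
  {f | ∀ y ∈ Y, |f y| ≤ 1}

/-- The supremum of `|det (f_j (x_i))|` over `n` points of `X` and `n` elements of the absolute
polar of `Y`. -/
noncomputable def detSup {E : Type*} [AddCommGroup E] [Module ℝ E] (X Y : Set E) (n : ℕ) : ℝ≥0∞ :=
  ⨆ (x : Fin n → X) (f : Fin n → absPolar Y),
    ENNReal.ofReal |(Matrix.of fun i j => (f j : Module.Dual ℝ E) (x i)).det|

section

variable {E : Type*} [AddCommGroup E] [Module ℝ E] {X X' Y : Set E}

theorem kolDiam_mono_left (h : X ⊆ X') (k : ℕ) : kolDiam X Y k ≤ kolDiam X' Y k :=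
  sInf_le_sInf (Set.image_mono fun _ ⟨hc, L, hL, hX⟩ => ⟨hc, L, hL, h.trans hX⟩)

theorem kolDiam_antitone (X Y : Set E) : Antitone (kolDiam X Y) := fun _ _ h =>
  sInf_le_sInf (Set.image_mono fun _ ⟨hc, L, hL, hX⟩ =>
    ⟨hc, L, hL.trans_le (by exact_mod_cast h), hX⟩)

theorem lkSet_le_kolDiam (X Y : Set E) (k : ℕ) : lkSet X Y k ≤ kolDiam X Y k :=
  iSup₂_le fun _ _ => kolDiam_mono_left Set.inter_subset_left k

theorem kolDiam_le_ofReal {c : ℝ} {k : ℕ} (hc : 0 < c) (L : Submodule ℝ E)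
    (hL : Module.rank ℝ L < k) (hX : X ⊆ c • Y + (L : Set E)) :
    kolDiam X Y k ≤ ENNReal.ofReal c :=
  sInf_le ⟨c, ⟨hc, L, hL, hX⟩, rfl⟩

theorem exists_of_kolDiam_lt {b : ℝ≥0∞} {k : ℕ} (h : kolDiam X Y k < b) :
    ∃ c : ℝ, 0 < c ∧ ENNReal.ofReal c < b ∧
      ∃ L : Submodule ℝ E, Module.rank ℝ L < k ∧ X ⊆ c • Y + (L : Set E) := by
  obtain ⟨_, ⟨c, ⟨hc, hL⟩, rfl⟩, hb⟩ := sInf_lt_iff.1 h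
  exact ⟨c, hc, hb, hL⟩

theorem exists_subset_smul_of_kolDiam_one_ne_top (h : kolDiam X Y 1 ≠ ⊤) :
    ∃ c : ℝ, 0 < c ∧ X ⊆ c • Y := by
  obtain ⟨c, hc, -, L, hL, hX⟩ := exists_of_kolDiam_lt h.lt_top
  have hL0 : L = ⊥ := by
    rw [← Submodule.rank_eq_zero, ← Cardinal.lt_one_iff]
    exact_mod_cast hL
  exact ⟨c, hc, by simpa [hL0] using hX⟩

theorem exists_mem_smul_of_mem_span (hYs : -Y = Y) (hYc : Convex ℝ Y) (hY : Y.Nonempty) {x : E}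
    (hx : x ∈ Submodule.span ℝ Y) : ∃ r : ℝ, 0 ≤ r ∧ x ∈ r • Y := by
  induction hx using Submodule.span_induction with
  | mem x hx => exact ⟨1, zero_le_one, by simpa using hx⟩
  | zero => exact ⟨0, le_rfl, by simp [Set.zero_smul_set hY]⟩
  | add x y _ _ hx hy =>
    obtain ⟨r, hr, hx⟩ := hx
    obtain ⟨s, hs, hy⟩ := hy
    exact ⟨r + s, add_nonneg hr hs, by
      rw [hYc.add_smul hr hs]; exact Set.add_mem_add hx hy⟩
  | smul a x _ hx =>
    obtain ⟨r, hr, y, hy, rfl⟩ := hx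
    refine ⟨|a| * r, by positivity, ?_⟩
    rcases abs_choice a with h | h
    · exact ⟨y, hy, by simp [h, mul_smul]⟩
    · refine ⟨-y, by rw [← hYs]; simpa using hy, by simp [h, mul_smul]⟩

theorem balanced_of_neg_eq (hYs : -Y = Y) (hYc : Convex ℝ Y) : Balanced ℝ Y :=
  (balanced_iff_neg_mem hYc).2 fun y hy => by rw [← hYs]; simpa using hy

/-- Bipolar theorem without topology. -/
theorem mem_smul_of_forall_absPolar (hYs : -Y = Y) (hYc : Convex ℝ Y) (hY : Y.Nonempty) {w : E}
    (hw : w ∈ Submodule.span ℝ Y) {b c : ℝ} (hbc : b < c) (h : ∀ f ∈ absPolar Y, |f w| ≤ b) :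
    w ∈ c • Y := by
  have hb : 0 ≤ b := by simpa using h 0 (by simp [absPolar])
  have hbal := balanced_of_neg_eq hYs hYc
  let S := Submodule.span ℝ Y
  let Z : Set S := S.subtype ⁻¹' Y
  have hZc : Convex ℝ Z := hYc.linear_preimage S.subtype
  have hZ : Absorbent ℝ Z := by
    intro x
    obtain ⟨r, -, hx⟩ := exists_mem_smul_of_mem_span hYs hYc hY x.2
    refine absorbs_iff_norm.2 ⟨max r 1 + |r|, fun a ha => Set.singleton_subset_iff.2 ?_⟩
    have ha0 : a ≠ 0 := by
      rintro rfl
      have := le_max_right r 1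
      have := abs_nonneg r
      simp at ha
      linarith
    have hr : ‖r‖ ≤ ‖a‖ := by
      have := le_max_right r 1
      simp only [Real.norm_eq_abs] at ha ⊢
      linarith
    have := hbal.smul_mono hr hx
    rw [Set.mem_smul_set_iff_inv_smul_mem₀ ha0] at this ⊢
    exact this
  have hsymm : ∀ y ∈ Y, -y ∈ Y := fun y hy => by rw [← hYs]; simpa using hy
  let v : S := ⟨w, hw⟩
  have hgauge : gauge Z v ≤ b := by
    by_cases hv : v = 0
    · simpa [hv] using hb
    obtain ⟨g, hg, hgle⟩ := exists_extension_of_le_sublinear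
      (LinearPMap.mkSpanSingleton v (gauge Z v) hv : S →ₗ.[ℝ] ℝ) (gauge Z)
      (fun a ha x => gauge_smul_of_nonneg ha.le x) (gauge_add_le hZc hZ) (by
        rintro ⟨x, hx⟩
        obtain ⟨t, rfl⟩ := Submodule.mem_span_singleton.1 hx
        rw [LinearPMap.mkSpanSingleton'_apply]
        simp only [RingHom.id_apply, smul_eq_mul]
        rcases le_total 0 t with ht | ht
        · rw [gauge_smul_of_nonneg ht, smul_eq_mul]
        · exact (mul_nonpos_of_nonpos_of_nonneg ht (gauge_nonneg _)).trans (gauge_nonneg _))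
    obtain ⟨f, hf⟩ := g.exists_extend
    have hfS : ∀ x : S, f x = g x := fun x => LinearMap.congr_fun hf x
    have hfY : f ∈ absPolar Y := by
      have key : ∀ y ∈ Y, f y ≤ 1 := fun y hy => by
        have := hfS ⟨y, Submodule.subset_span hy⟩
        simp only at this
        rw [this]
        exact (hgle _).trans (gauge_le_one_of_mem (by exact hy))
      intro y hy
      have := key _ (hsymm y hy)
      rw [map_neg] at this
      exact abs_le.2 ⟨by linarith, key y hy⟩
    have hgv : g v = gauge Z v := by
      rw [hg ⟨v, Submodule.mem_span_singleton_self v⟩]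
      exact LinearPMap.mkSpanSingleton_apply ℝ ℝ hv _
    calc gauge Z v = f w := by rw [← hgv, ← hfS]
      _ ≤ b := (le_abs_self _).trans (h f hfY)
  obtain ⟨r, hr, hrc, z, hz, hzv⟩ := exists_lt_of_gauge_lt hZ (hgauge.trans_lt hbc)
  have hwr : w ∈ r • Y := ⟨z, hz, congrArg Subtype.val hzv⟩
  refine hbal.smul_mono ?_ hwr
  rw [Real.norm_of_nonneg hr.le, Real.norm_of_nonneg (hr.trans hrc).le]
  exact hrc.le

theorem abs_apply_le_of_mem_smul {f : Module.Dual ℝ E} (hf : f ∈ absPolar Y) {c : ℝ} (hc : 0 ≤ c)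
    {x : E} (hx : x ∈ c • Y) : |f x| ≤ c := by
  obtain ⟨y, hy, rfl⟩ := hx
  simpa [abs_mul, abs_of_nonneg hc] using mul_le_mul_of_nonneg_left (hf y hy) hc

theorem ofReal_abs_det_le_detSup {n : ℕ} {x : Fin n → E} {f : Fin n → Module.Dual ℝ E}
    (hx : ∀ i, x i ∈ X) (hf : ∀ i, f i ∈ absPolar Y) :
    ENNReal.ofReal |(Matrix.of fun i j => f j (x i)).det| ≤ detSup X Y n :=
  le_iSup₂_of_le (fun i => ⟨x i, hx i⟩) (fun i => ⟨f i, hf i⟩) le_rfl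

theorem abs_det_le_toReal_detSup {n : ℕ} (h : detSup X Y n ≠ ⊤) {x : Fin n → E}
    {f : Fin n → Module.Dual ℝ E} (hx : ∀ i, x i ∈ X) (hf : ∀ i, f i ∈ absPolar Y) :
    |(Matrix.of fun i j => f j (x i)).det| ≤ (detSup X Y n).toReal :=
  (ENNReal.ofReal_le_iff_le_toReal h).1 (ofReal_abs_det_le_detSup hx hf)

theorem detSup_zero : detSup X Y 0 = 1 := by
  simp [detSup]

theorem detSup_ne_top {c : ℝ} (hc : 0 ≤ c) (hX : X ⊆ c • Y) (n : ℕ) : detSup X Y n ≠ ⊤ := by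
  refine ne_top_of_le_ne_top (b := ENNReal.ofReal (n.factorial • c ^ n)) ENNReal.ofReal_ne_top
    (iSup₂_le fun x f => ENNReal.ofReal_le_ofReal ?_)
  have := Matrix.det_le (A := Matrix.of fun i j => (f j : Module.Dual ℝ E) (x i))
    (abv := AbsoluteValue.abs) (x := c)
    fun i j => abs_apply_le_of_mem_smul (f j).2 hc (hX (x i).2)
  simpa using this

/-- If `w = z - ∑ aᵢ xᵢ` is annihilated by all `fⱼ`, then the bordered determinant factors. -/
theorem det_cons_eq_mul_det {n : ℕ} (x : Fin n → E) (f : Fin n → Module.Dual ℝ E) (z : E)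
    (g : Module.Dual ℝ E) (a : Fin n → ℝ) (hw : ∀ j, f j (z - ∑ i, a i • x i) = 0) :
    (Matrix.of fun i j => (Fin.cons g f : Fin (n + 1) → Module.Dual ℝ E) j
      ((Fin.cons z x : Fin (n + 1) → E) i)).det =
      g (z - ∑ i, a i • x i) * (Matrix.of fun i j => f j (x i)).det := by
  let F : Fin (n + 1) → Module.Dual ℝ E := Fin.cons g f
  let ψ : E [⋀^Fin (n + 1)]→ₗ[ℝ] ℝ := Matrix.detRowAlternating.compLinearMap (LinearMap.pi F)
  let φ : E →ₗ[ℝ] ℝ :=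
    { toFun := fun u => ψ.curryLeft u x
      map_add' := fun u v => by rw [map_add, AlternatingMap.add_apply]
      map_smul' := fun t u => by rw [map_smul, AlternatingMap.smul_apply, RingHom.id_apply] }
  have hφ : ∀ u : E, (Matrix.of fun i j => F j ((Fin.cons u x : Fin (n + 1) → E) i)).det = φ u :=
    fun u => rfl
  have hx : ∀ i, φ (x i) = 0 := fun i =>
    ψ.map_eq_zero_of_eq (i := 0) (j := i.succ) _ (by simp) (Fin.succ_ne_zero i).symm
  have hsub : φ z = φ (z - ∑ i, a i • x i) := by simp [hx]
  rw [hφ, hsub, ← hφ, Matrix.det_succ_row_zero, Fin.sum_univ_succ]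
  simp only [F, Matrix.of_apply, Fin.cons_zero, Fin.cons_succ, hw, mul_zero, zero_mul,
    Finset.sum_const_zero, add_zero, Fin.val_zero, pow_zero, one_mul]
  rfl

theorem rank_span_range_fin_le {n : ℕ} (x : Fin n → E) :
    Module.rank ℝ (Submodule.span ℝ (Set.range x)) ≤ n := by
  refine (rank_span_le _).trans ?_
  simpa using Cardinal.mk_range_le_lift (f := x)

theorem kolDiam_mul_detSup_le (hYs : -Y = Y) (hYc : Convex ℝ Y) {C : ℝ} (hC : 0 < C)
    (hXC : X ⊆ C • Y) (n : ℕ) :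
    kolDiam X Y (n + 1) * detSup X Y n ≤ detSup X Y (n + 1) := by
  rw [detSup, ENNReal.mul_iSup]
  refine iSup_le fun x => ?_
  rw [ENNReal.mul_iSup]
  refine iSup_le fun f => ?_
  set A : Matrix (Fin n) (Fin n) ℝ := Matrix.of fun i j => (f j : Module.Dual ℝ E) (x i) with hA
  by_cases hD : A.det = 0
  · simp [hD]
  have hD' : 0 < |A.det| := abs_pos.2 hD
  have hT := detSup_ne_top hC.le hXC (n + 1)
  set T := (detSup X Y (n + 1)).toReal with hTdef
  have hspan : X ⊆ Submodule.span ℝ Y := fun z hz => by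
    obtain ⟨y, hy, rfl⟩ := hXC hz
    exact Submodule.smul_mem _ _ (Submodule.subset_span hy)
  have key : kolDiam X Y (n + 1) ≤ ENNReal.ofReal (T / |A.det|) := by
    refine ENNReal.le_of_forall_pos_le_add fun ε hε _ => ?_
    have hT0 : 0 ≤ T / |A.det| := div_nonneg ENNReal.toReal_nonneg hD'.le
    have hε' : (0 : ℝ) < ε := hε
    rw [← ENNReal.ofReal_coe_nnreal, ← ENNReal.ofReal_add hT0 hε'.le]
    refine kolDiam_le_ofReal (by positivity)
      (Submodule.span ℝ (Set.range fun i => (x i : E))) ?_ fun z hz => ?_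
    · exact (rank_span_range_fin_le _).trans_lt (Nat.cast_lt.2 n.lt_succ_self)
    · obtain ⟨a, ha⟩ := Matrix.vecMul_surjective_iff_isUnit.2
        ((Matrix.isUnit_iff_isUnit_det A).2 (isUnit_iff_ne_zero.2 hD))
        fun j => (f j : Module.Dual ℝ E) z
      have hw : ∀ j, (f j : Module.Dual ℝ E) (z - ∑ i, a i • (x i : E)) = 0 := fun j => by
        have := congrFun ha j
        simp only [Matrix.vecMul, dotProduct, hA, Matrix.of_apply] at this
        simp [← this]
      have hsum : ∑ i, a i • (x i : E) ∈ Submodule.span ℝ (Set.range fun i => (x i : E)) :=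
        Submodule.sum_mem _ fun i _ => Submodule.smul_mem _ _ (Submodule.subset_span ⟨i, rfl⟩)
      refine ⟨z - ∑ i, a i • (x i : E), ?_, _, hsum, by simp⟩
      have hY : Y.Nonempty := by
        obtain ⟨y, hy, -⟩ := hXC hz
        exact ⟨y, hy⟩
      refine mem_smul_of_forall_absPolar hYs hYc hY ?_ (b := T / |A.det|) (by linarith)
        fun g hg => ?_
      · exact Submodule.sub_mem _ (hspan hz) (Submodule.sum_mem _ fun i _ =>
          Submodule.smul_mem _ _ (hspan (x i).2))
      · rw [le_div_iff₀ hD', ← abs_mul, hA,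
          ← det_cons_eq_mul_det (fun i => (x i : E)) (fun j => (f j : Module.Dual ℝ E)) z g a hw]
        refine abs_det_le_toReal_detSup hT (fun i => ?_) fun i => ?_
        · refine Fin.cases hz (fun i => (x i).2) i
        · refine Fin.cases hg (fun i => (f i).2) i
  calc kolDiam X Y (n + 1) * ENNReal.ofReal |A.det|
      ≤ ENNReal.ofReal (T / |A.det|) * ENNReal.ofReal |A.det| := by gcongr
    _ = detSup X Y (n + 1) := by
      rw [← ENNReal.ofReal_mul' hD'.le, div_mul_cancel₀ _ hD'.ne', ENNReal.ofReal_toReal hT]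

/-- On a subspace of dimension less than `n`, some normalised combination of `n` functionals
vanishes. -/
theorem exists_abs_le_one_sum_smul_eq_zero {n : ℕ} (f : Fin n → Module.Dual ℝ E)
    (L : Submodule ℝ E) (hL : Module.rank ℝ L < n) :
    ∃ (b : Fin n → ℝ) (i₀ : Fin n), b i₀ = 1 ∧ (∀ i, |b i| ≤ 1) ∧
      ∀ l ∈ L, ∑ i, b i * f i l = 0 := by
  have : Module.Finite ℝ L :=
    Module.rank_lt_aleph0_iff.1 (hL.trans (Cardinal.natCast_lt_aleph0))
  have hdep : ¬ LinearIndependent ℝ fun i => (f i).comp L.subtype := fun hli => by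
    have h1 := hli.fintype_card_le_finrank
    rw [Fintype.card_fin] at h1
    have h2 : Module.finrank ℝ (L →ₗ[ℝ] ℝ) = Module.finrank ℝ L := Subspace.dual_finrank_eq
    rw [h2] at h1
    rw [← Module.finrank_eq_rank] at hL
    exact absurd h1 (not_le.2 (by exact_mod_cast hL))
  obtain ⟨a, ha, j, hj⟩ := Fintype.not_linearIndependent_iff.1 hdep
  have : Nonempty (Fin n) := ⟨j⟩
  obtain ⟨i₀, hi₀⟩ := Finite.exists_max fun i => |a i|
  have hpos : 0 < |a i₀| := (abs_pos.2 hj).trans_le (hi₀ j)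
  refine ⟨fun i => a i / a i₀, i₀, div_self (abs_pos.1 hpos), fun i => ?_, fun l hl => ?_⟩
  · rw [abs_div]
    exact (div_le_one hpos).2 (hi₀ i)
  · have := LinearMap.congr_fun ha ⟨l, hl⟩
    simp only [LinearMap.sum_apply, LinearMap.smul_apply, LinearMap.comp_apply,
      Submodule.subtype_apply, smul_eq_mul, LinearMap.zero_apply] at this
    simp_rw [div_mul_eq_mul_div]
    rw [← Finset.sum_div, this, zero_div]

theorem abs_det_le_sq_mul_detSup {n : ℕ} (hn : detSup X Y n ≠ ⊤) {x : Fin (n + 1) → E}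
    {f : Fin (n + 1) → Module.Dual ℝ E} (hx : ∀ i, x i ∈ X) (hf : ∀ i, f i ∈ absPolar Y)
    {c : ℝ} (hc : 0 ≤ c) {L : Submodule ℝ E} (hL : Module.rank ℝ L < (n + 1 : ℕ))
    (hxL : ∀ i, x i ∈ c • Y + (L : Set E)) :
    |(Matrix.of fun i j => f j (x i)).det| ≤
      ((n + 1 : ℕ) : ℝ) ^ 2 * c * (detSup X Y n).toReal := by
  obtain ⟨b, i₀, hb₀, hb, hbL⟩ := exists_abs_le_one_sum_smul_eq_zero f L hL
  set A : Matrix (Fin (n + 1)) (Fin (n + 1)) ℝ := Matrix.of fun i j => f j (x i) with hA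
  have hdet := Matrix.det_updateCol_sum A i₀ b
  rw [hb₀, one_smul, Matrix.det_succ_column _ i₀] at hdet
  have hcol : ∀ i, |∑ j, b j • A i j| ≤ ((n + 1 : ℕ) : ℝ) * c := fun i => by
    obtain ⟨y, hy, l, hl, hyl⟩ := hxL i
    have : ∑ j, b j • A i j = ∑ j, b j * f j y := by
      have hl' := hbL l hl
      simp only [hA, Matrix.of_apply, ← hyl, map_add, smul_eq_mul, mul_add,
        Finset.sum_add_distrib, hl', add_zero]
    rw [this]
    calc |∑ j, b j * f j y| ≤ ∑ j, |b j * f j y| := Finset.abs_sum_le_sum_abs _ _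
      _ ≤ ∑ _j : Fin (n + 1), c := Finset.sum_le_sum fun j _ => by
        rw [abs_mul]
        exact (mul_le_mul (hb j) (abs_apply_le_of_mem_smul (hf j) hc hy) (abs_nonneg _)
          zero_le_one).trans_eq (one_mul c)
      _ = ((n + 1 : ℕ) : ℝ) * c := by simp
  rw [← hdet]
  calc _ ≤ ∑ _i : Fin (n + 1), ((n + 1 : ℕ) : ℝ) * c * (detSup X Y n).toReal := by
        refine (Finset.abs_sum_le_sum_abs _ _).trans (Finset.sum_le_sum fun i _ => ?_)
        rw [Matrix.submatrix_updateCol_succAbove, Matrix.updateCol_self, abs_mul, abs_mul,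
          abs_pow, abs_neg, abs_one, one_pow, one_mul]
        exact mul_le_mul (hcol i) (abs_det_le_toReal_detSup hn (fun k => hx (i.succAbove k))
          fun k => hf (i₀.succAbove k)) (abs_nonneg _) (by positivity)
    _ = _ := by simp; ring

theorem detSup_succ_le {n : ℕ} (hn : detSup X Y n ≠ ⊤) (hl : lkSet X Y (n + 1) ≠ ⊤) :
    detSup X Y (n + 1) ≤ ((n + 1 : ℕ) : ℝ≥0∞) ^ 2 * lkSet X Y (n + 1) * detSup X Y n := by
  refine iSup₂_le fun x f => ?_
  set D := |(Matrix.of fun i j => (f j : Module.Dual ℝ E) (x i)).det| with hD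
  let N := Submodule.span ℝ (Set.range fun i => (x i : E))
  have hN : Module.rank ℝ N ≤ (n + 1 : ℕ) := rank_span_range_fin_le _
  have hlN : kolDiam (X ∩ (N : Set E)) Y (n + 1) ≤ lkSet X Y (n + 1) :=
    le_iSup₂_of_le N hN le_rfl
  set K : ℝ≥0∞ := ((n + 1 : ℕ) : ℝ≥0∞) ^ 2 * detSup X Y n with hK
  have hKtop : K ≠ ⊤ := ENNReal.mul_ne_top (by finiteness) hn
  have key : ∀ b, lkSet X Y (n + 1) < b → ENNReal.ofReal D ≤ K * b := fun b hb => by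
    obtain ⟨c, hc, hcb, L, hL, hXL⟩ := exists_of_kolDiam_lt (hlN.trans_lt hb)
    have h := abs_det_le_sq_mul_detSup hn (fun i => (x i).2) (fun i => (f i).2) hc.le hL
      fun i => hXL ⟨(x i).2, Submodule.subset_span ⟨i, rfl⟩⟩
    calc ENNReal.ofReal D
        ≤ ENNReal.ofReal (((n + 1 : ℕ) : ℝ) ^ 2 * c * (detSup X Y n).toReal) :=
          ENNReal.ofReal_le_ofReal h
      _ = K * ENNReal.ofReal c := by
        rw [ENNReal.ofReal_mul (by positivity), ENNReal.ofReal_mul (by positivity),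
          ENNReal.ofReal_pow (by positivity), ENNReal.ofReal_natCast, ENNReal.ofReal_toReal hn, hK]
        ring
      _ ≤ K * b := by gcongr
  have hle : ENNReal.ofReal D ≤ K * lkSet X Y (n + 1) := by
    by_cases hK0 : K = 0
    · simpa [hK0] using key ⊤ hl.lt_top
    · rw [mul_comm, ← ENNReal.div_le_iff hK0 hKtop]
      refine le_of_forall_gt fun b hb => ?_
      obtain ⟨b', hb', hbb'⟩ := exists_between hb
      refine lt_of_le_of_lt ?_ hbb'
      rw [ENNReal.div_le_iff hK0 hKtop, mul_comm]
      exact key b' hb'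
  exact hle.trans_eq (by rw [hK]; ring)

theorem kolDiam_succ_eq_zero_of_detSup_eq_zero (hYs : -Y = Y) (hYc : Convex ℝ Y) {C : ℝ}
    (hC : 0 < C) (hXC : X ⊆ C • Y) {n : ℕ} (h : detSup X Y n = 0) :
    kolDiam X Y (n + 1) = 0 := by
  induction n with
  | zero => simp [detSup_zero] at h
  | succ n ih =>
    refine le_antisymm ((kolDiam_antitone X Y (n + 1).le_succ).trans ?_) bot_le
    have := kolDiam_mul_detSup_le hYs hYc hC hXC n
    rw [h, nonpos_iff_eq_zero, mul_eq_zero] at this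
    exact (this.elim id ih).le

end

theorem lkSet_le_kolDiam_le_ksq_lkSet {E : Type*} [AddCommGroup E] [Module ℝ E] (X Y : Set E)
    (hXs : -X = X) (hXc : Convex ℝ X) (hYs : -Y = Y) (hYc : Convex ℝ Y)
    (hfin : kolDiam X Y 1 ≠ ⊤) :
    ∀ k : ℕ, 1 ≤ k → lkSet X Y k ≤ kolDiam X Y k ∧
      kolDiam X Y k ≤ (k : ℝ≥0∞) ^ 2 * lkSet X Y k := by
  intro k hk
  refine ⟨lkSet_le_kolDiam X Y k, ?_⟩
  obtain ⟨n, rfl⟩ := Nat.exists_eq_add_of_le' hk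
  obtain ⟨C, hC, hXC⟩ := exists_subset_smul_of_kolDiam_one_ne_top hfin
  have hl : lkSet X Y (n + 1) ≠ ⊤ := ne_top_of_le_ne_top hfin
    ((lkSet_le_kolDiam X Y (n + 1)).trans (kolDiam_antitone X Y hk))
  by_cases h0 : detSup X Y n = 0
  · simp [kolDiam_succ_eq_zero_of_detSup_eq_zero hYs hYc hC hXC h0]
  · have hn := detSup_ne_top hC.le hXC n
    exact (ENNReal.mul_le_mul_iff_left h0 hn).1
      ((kolDiam_mul_detSup_le hYs hYc hC hXC n).trans (detSup_succ_le hn hl))
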